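/- arXiv:2602.07863 — 2 statements merged into one kernel-verified Lean document; each statement's English description precedes it below -/
import Mathlib

section
/- Fix n ≥ 3 and let λ : L_n → GL_n(ℂ) be a 2-local representation, i.e. λ(ℓ_i) = diag(I_{i-1}, M_i, I_{n-i-1}) with M_i ∈ GL_2(ℂ) for each 1 ≤ i ≤ n-1. Then there exists a group homomorphism λ̂₁ : VL_n → GL_n(ℂ) with λ̂₁(ℓ_i) = λ(ℓ_i) and λ̂₁(ρ_i) = λ(ℓ_i) for all 1 ≤ i ≤ n-1. Moreover λ̂₁ respects the welded relations, i.e. it induces a group homomorphism WL_n → GL_n(ℂ). -/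
/-- The defining relations of the triplet group `L_n`:
generators `l_1, ..., l_{n-1}` (indexed here by `Fin (n-1)`, index `i` corresponding
to `l_{i+1}`), and relations `l_i ^ 2 = 1`, `l_i l_{i+1} l_i = l_{i+1} l_i l_{i+1}`. -/
def tripletRels (n : ℕ) : Set (FreeGroup (Fin (n - 1))) :=
  {r | (∃ i : Fin (n - 1), r = FreeGroup.of i * FreeGroup.of i) ∨
    ∃ i j : Fin (n - 1), (i : ℕ) + 1 = (j : ℕ) ∧
      r = FreeGroup.of i * FreeGroup.of j * FreeGroup.of i *
          (FreeGroup.of j * FreeGroup.of i * FreeGroup.of j)⁻¹}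

/-- The triplet group `L_n`. -/
abbrev TripletGroup (n : ℕ) := PresentedGroup (tripletRels n)

/-- The generator `l_{i+1}` of the triplet group. -/
def ell {n : ℕ} (i : Fin (n - 1)) : TripletGroup n := PresentedGroup.of i

/-- The `n x n` matrix `diag(I_i, M, I_{n-i-2})`: it agrees with the identity matrix
except in the `2 x 2` block in rows/columns `i, i+1` (0-based), where it equals `M`. -/
def locMat {R : Type*} [CommRing R] (n : ℕ) (i : ℕ)
    (M : Matrix (Fin 2) (Fin 2) R) : Matrix (Fin n) (Fin n) R :=
  Matrix.of fun a b =>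
    if (a : ℕ) = i ∧ (b : ℕ) = i then M 0 0
    else if (a : ℕ) = i ∧ (b : ℕ) = i + 1 then M 0 1
    else if (a : ℕ) = i + 1 ∧ (b : ℕ) = i then M 1 0
    else if (a : ℕ) = i + 1 ∧ (b : ℕ) = i + 1 then M 1 1
    else if (a : ℕ) = (b : ℕ) then 1 else 0

/-- The defining relations of the virtual triplet group `VL_n`: generators
`l_i = Sum.inl i` and `rho_i = Sum.inr i` for `i : Fin (n-1)` (0-based), with the
triplet relations on the `l_i`, together with `rho_i ^ 2 = 1`,
`rho_i rho_j = rho_j rho_i` for `|i-j| >= 2`,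
`rho_i rho_{i+1} rho_i = rho_{i+1} rho_i rho_{i+1}`, `l_i rho_j = rho_j l_i` for
`|i-j| >= 2`, and `rho_i rho_{i+1} l_i = l_{i+1} rho_i rho_{i+1}`. -/
def vtripletRels (n : ℕ) : Set (FreeGroup (Fin (n - 1) ⊕ Fin (n - 1))) :=
  {r | (∃ i : Fin (n - 1), r = FreeGroup.of (.inl i) * FreeGroup.of (.inl i)) ∨
    (∃ i j : Fin (n - 1), (i : ℕ) + 1 = (j : ℕ) ∧
      r = FreeGroup.of (.inl i) * FreeGroup.of (.inl j) * FreeGroup.of (.inl i) *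
          (FreeGroup.of (.inl j) * FreeGroup.of (.inl i) * FreeGroup.of (.inl j))⁻¹) ∨
    (∃ i : Fin (n - 1), r = FreeGroup.of (.inr i) * FreeGroup.of (.inr i)) ∨
    (∃ i j : Fin (n - 1), ((i : ℕ) + 2 ≤ (j : ℕ) ∨ (j : ℕ) + 2 ≤ (i : ℕ)) ∧
      r = FreeGroup.of (.inr i) * FreeGroup.of (.inr j) *
          (FreeGroup.of (.inr j) * FreeGroup.of (.inr i))⁻¹) ∨
    (∃ i j : Fin (n - 1), (i : ℕ) + 1 = (j : ℕ) ∧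
      r = FreeGroup.of (.inr i) * FreeGroup.of (.inr j) * FreeGroup.of (.inr i) *
          (FreeGroup.of (.inr j) * FreeGroup.of (.inr i) * FreeGroup.of (.inr j))⁻¹) ∨
    (∃ i j : Fin (n - 1), ((i : ℕ) + 2 ≤ (j : ℕ) ∨ (j : ℕ) + 2 ≤ (i : ℕ)) ∧
      r = FreeGroup.of (.inl i) * FreeGroup.of (.inr j) *
          (FreeGroup.of (.inr j) * FreeGroup.of (.inl i))⁻¹) ∨
    (∃ i j : Fin (n - 1), (i : ℕ) + 1 = (j : ℕ) ∧
      r = FreeGroup.of (.inr i) * FreeGroup.of (.inr j) * FreeGroup.of (.inl i) *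
          (FreeGroup.of (.inl j) * FreeGroup.of (.inr i) * FreeGroup.of (.inr j))⁻¹)}

/-- The virtual triplet group `VL_n`. -/
abbrev VTripletGroup (n : ℕ) := PresentedGroup (vtripletRels n)

/-- The generator `l_{i+1}` of `VL_n`. -/
def ellV {n : ℕ} (i : Fin (n - 1)) : VTripletGroup n := PresentedGroup.of (Sum.inl i)

/-- The generator `rho_{i+1}` of `VL_n`. -/
def rhoV {n : ℕ} (i : Fin (n - 1)) : VTripletGroup n := PresentedGroup.of (Sum.inr i)

/-- The defining relations of the welded triplet group `WL_n`: those of `VL_n` together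
with the welded relations `rho_i l_{i+1} l_i = l_{i+1} l_i rho_{i+1}`. -/
def wtripletRels (n : ℕ) : Set (FreeGroup (Fin (n - 1) ⊕ Fin (n - 1))) :=
  vtripletRels n ∪
    {r | ∃ i j : Fin (n - 1), (i : ℕ) + 1 = (j : ℕ) ∧
      r = FreeGroup.of (.inr i) * FreeGroup.of (.inl j) * FreeGroup.of (.inl i) *
          (FreeGroup.of (.inl j) * FreeGroup.of (.inl i) * FreeGroup.of (.inr j))⁻¹}

/-- The welded triplet group `WL_n`. -/
abbrev WTripletGroup (n : ℕ) := PresentedGroup (wtripletRels n)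

/-- The generator `l_{i+1}` of `WL_n`. -/
def ellW {n : ℕ} (i : Fin (n - 1)) : WTripletGroup n := PresentedGroup.of (Sum.inl i)

/-- The generator `rho_{i+1}` of `WL_n`. -/
def rhoW {n : ℕ} (i : Fin (n - 1)) : WTripletGroup n := PresentedGroup.of (Sum.inr i)

theorem locMat_sub_one_apply_eq_zero {R : Type*} [CommRing R] {n i : ℕ}
    {M : Matrix (Fin 2) (Fin 2) R} {a b : Fin n}
    (h : ((a : ℕ) ≠ i ∧ (a : ℕ) ≠ i + 1) ∨ ((b : ℕ) ≠ i ∧ (b : ℕ) ≠ i + 1)) :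
    (locMat n i M - 1) a b = 0 := by
  simp only [locMat, Matrix.sub_apply, Matrix.of_apply, Matrix.one_apply, Fin.ext_iff]
  split_ifs <;> first | omega | simp

theorem locMat_sub_one_mul_locMat_sub_one {R : Type*} [CommRing R] {n i j : ℕ}
    (h : i + 2 ≤ j ∨ j + 2 ≤ i) (A B : Matrix (Fin 2) (Fin 2) R) :
    (locMat n i A - 1) * (locMat n j B - 1) = 0 := by
  ext a b
  rw [Matrix.mul_apply]
  refine Finset.sum_eq_zero fun c _ => ?_
  by_cases hc : (c : ℕ) ≠ i ∧ (c : ℕ) ≠ i + 1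
  · rw [locMat_sub_one_apply_eq_zero (.inr hc), zero_mul]
  · rw [locMat_sub_one_apply_eq_zero (i := j) (.inl (by omega)), mul_zero]

/-- Matrices acting on disjoint `2 x 2` blocks commute. -/
theorem commute_locMat {R : Type*} [CommRing R] {n i j : ℕ}
    (h : i + 2 ≤ j ∨ j + 2 ≤ i) (A B : Matrix (Fin 2) (Fin 2) R) :
    Commute (locMat n i A) (locMat n j B) := by
  have hsub : Commute (locMat n i A - 1) (locMat n j B - 1) :=
    (locMat_sub_one_mul_locMat_sub_one h A B).trans
      (locMat_sub_one_mul_locMat_sub_one h.symm B A).symm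
  simpa using
    (hsub.add_right (Commute.one_right _)).add_left (Commute.one_left _)

theorem ell_mul_self {n : ℕ} (i : Fin (n - 1)) : ell i * ell i = 1 :=
  PresentedGroup.one_of_mem (rels := tripletRels n) (.inl ⟨i, rfl⟩)

theorem ell_braid {n : ℕ} {i j : Fin (n - 1)} (hij : (i : ℕ) + 1 = j) :
    ell i * ell j * ell i = ell j * ell i * ell j :=
  PresentedGroup.mk_eq_mk_of_mul_inv_mem (rels := tripletRels n) (.inr ⟨i, j, hij, rfl⟩)

/-- If the images of distant generators of `L_n` commute, then sending both `l_i` and `rho_i`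
to the image of `l_i` respects all the relations of `WL_n`. -/
theorem lift_eq_one_of_mem_wtripletRels {G : Type*} [Group G] {n : ℕ} (f : TripletGroup n →* G)
    (hf : ∀ i j : Fin (n - 1), ((i : ℕ) + 2 ≤ j ∨ (j : ℕ) + 2 ≤ i) →
      Commute (f (ell i)) (f (ell j))) :
    ∀ r ∈ wtripletRels n,
      FreeGroup.lift (Sum.elim (fun i => f (ell i)) (fun i => f (ell i))) r = 1 := by
  have sq (i : Fin (n - 1)) : f (ell i) * f (ell i) = 1 := by
    rw [← map_mul, ell_mul_self, map_one]
  have braid {i j : Fin (n - 1)} (hij : (i : ℕ) + 1 = j) :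
      f (ell i) * f (ell j) * f (ell i) = f (ell j) * f (ell i) * f (ell j) := by
    simp only [← map_mul, ell_braid hij]
  rintro r ((⟨i, rfl⟩ | ⟨i, j, hij, rfl⟩ | ⟨i, rfl⟩ | ⟨i, j, hij, rfl⟩ | ⟨i, j, hij, rfl⟩ |
    ⟨i, j, hij, rfl⟩ | ⟨i, j, hij, rfl⟩) | ⟨i, j, hij, rfl⟩) <;>
    simp only [map_mul, map_inv, FreeGroup.lift_apply_of, Sum.elim_inl, Sum.elim_inr,
      mul_inv_eq_one]
  · exact sq i
  · exact braid hij
  · exact sq i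
  · exact hf i j hij
  · exact braid hij
  · exact hf i j hij
  · exact braid hij
  · exact braid hij

/-- Fix `n >= 3` and let `lam : L_n → GL_n(ℂ)` be a 2-local
representation. Then there is a group homomorphism `lam1 : VL_n → GL_n(ℂ)` with
`lam1 (l_i) = lam (l_i)` and `lam1 (rho_i) = lam (l_i)` for all `i`; moreover it
respects the welded relations, i.e. it also induces a homomorphism `WL_n → GL_n(ℂ)`
with the same values on generators. -/
theorem two_local_extends_standard (n : ℕ) (hn : 3 ≤ n)
    (lam : TripletGroup n →* Matrix.GeneralLinearGroup (Fin n) ℂ)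
    (M : Fin (n - 1) → Matrix (Fin 2) (Fin 2) ℂ)
    (hloc : ∀ i : Fin (n - 1), Units.val (lam (ell i)) = locMat n (i : ℕ) (M i)) :
    (∃ lam1 : VTripletGroup n →* Matrix.GeneralLinearGroup (Fin n) ℂ,
      (∀ i : Fin (n - 1), lam1 (ellV i) = lam (ell i)) ∧
      (∀ i : Fin (n - 1), lam1 (rhoV i) = lam (ell i))) ∧
    (∃ lam1W : WTripletGroup n →* Matrix.GeneralLinearGroup (Fin n) ℂ,
      (∀ i : Fin (n - 1), lam1W (ellW i) = lam (ell i)) ∧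
      (∀ i : Fin (n - 1), lam1W (rhoW i) = lam (ell i))) := by
  have hcomm (i j : Fin (n - 1)) (hij : (i : ℕ) + 2 ≤ j ∨ (j : ℕ) + 2 ≤ i) :
      Commute (lam (ell i)) (lam (ell j)) := by
    rw [← Commute.units_val_iff, hloc, hloc]
    exact commute_locMat hij _ _
  have hW := lift_eq_one_of_mem_wtripletRels lam hcomm
  exact ⟨⟨PresentedGroup.toGroup fun r hr => hW r (.inl hr),
      fun _ => PresentedGroup.toGroup.of _, fun _ => PresentedGroup.toGroup.of _⟩,
    ⟨PresentedGroup.toGroup hW,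
      fun _ => PresentedGroup.toGroup.of _, fun _ => PresentedGroup.toGroup.of _⟩⟩
end

section
/- Fix n ≥ 3. Let M = [[a,b],[c,d]] and N = [[w,x],[y,z]] be invertible 2×2 complex matrices, not both equal to I₂, and for 1 ≤ i ≤ n-1 set L_i = diag(I_{i-1}, M, I_{n-i-1}) and R_i = diag(I_{i-1}, N, I_{n-i-1}) in GL_n(ℂ). Suppose L_i² = I_n, R_i² = I_n for 1 ≤ i ≤ n-1, L_iL_{i+1}L_i = L_{i+1}L_iL_{i+1}, R_iR_{i+1}R_i = R_{i+1}R_iR_{i+1}, and R_iR_{i+1}L_i = L_{i+1}R_iR_{i+1} for 1 ≤ i ≤ n-2 (so that ℓ_i ↦ L_i, ρ_i ↦ R_i defines a non-trivial homogeneous 2-local representation of VL_n). Then there exists x ∈ ℂ* such that N = [[0,x],[1/x,0]], and either M = I₂, or there exists b ∈ ℂ* such that M = [[0,b],[1/b,0]]. -/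
/-- An involutive `2 x 2` block whose shifts satisfy the braid relation is the identity or
anti-diagonal. -/
theorem eq_one_or_antidiag_of_locMat_braid {K : Type*} [Field K] (m : ℕ)
    (M : Matrix (Fin 2) (Fin 2) K)
    (hsq : locMat (m + 3) 0 M * locMat (m + 3) 0 M = 1)
    (hbr : locMat (m + 3) 0 M * locMat (m + 3) 1 M * locMat (m + 3) 0 M =
      locMat (m + 3) 1 M * locMat (m + 3) 0 M * locMat (m + 3) 1 M) :
    M = 1 ∨ ∃ b : K, b ≠ 0 ∧ M = !![0, b; 1 / b, 0] := by
  have s00 := congrFun₂ hsq 0 0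
  have s01 := congrFun₂ hsq 0 1
  have s11 := congrFun₂ hsq 1 1
  have b00 := congrFun₂ hbr 0 0
  have b01 := congrFun₂ hbr 0 1
  have b10 := congrFun₂ hbr 1 0
  have b11 := congrFun₂ hbr 1 1
  simp [Matrix.mul_apply, Fin.sum_univ_succ, locMat] at s00 s01 s11 b00 b01 b10 b11
  by_cases ha : M 0 0 = 0
  · have hbc : M 0 1 * M 1 0 = 1 := by grind
    have hb : M 0 1 ≠ 0 := left_ne_zero_of_mul_eq_one hbc
    refine .inr ⟨M 0 1, hb, ?_⟩
    have hd : M 1 1 = 0 := by grind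
    have hc : M 1 0 = 1 / M 0 1 := by grind
    rw [← hc]
    ext i j
    fin_cases i <;> fin_cases j <;> simp [ha, hd]
  · have h1 : M 0 0 = 1 := by grind
    have hd : M 1 1 = 1 := by grind
    have hb : M 0 1 = 0 := by grind
    have hc : M 1 0 = 0 := by grind
    left
    ext i j
    fin_cases i <;> fin_cases j <;> simp [h1, hd, hb, hc]

/-- The block matrix of the identity is the identity. -/
theorem locMat_one {R : Type*} [CommRing R] (n i : ℕ) :
    locMat n i (1 : Matrix (Fin 2) (Fin 2) R) = 1 := by
  ext a b
  simp only [locMat, Matrix.of_apply, Matrix.one_apply, Fin.ext_iff]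
  grind

/-- If two consecutive shifts of a block coincide, the block is the identity. -/
theorem eq_one_of_locMat_eq {R : Type*} [CommRing R] (m : ℕ) (M : Matrix (Fin 2) (Fin 2) R)
    (h : locMat (m + 3) 0 M = locMat (m + 3) 1 M) : M = 1 := by
  have h00 := congrFun₂ h 0 0
  have h01 := congrFun₂ h 0 1
  have h10 := congrFun₂ h 1 0
  have h22 := congrFun₂ h ⟨2, by omega⟩ ⟨2, by omega⟩
  simp [locMat] at h00 h01 h10 h22
  ext i j
  fin_cases i <;> fin_cases j <;> simp [*]

/-- Fix `n >= 3`. Let `M, N` be invertible `2 x 2` complex matrices,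
not both the identity, and let `L_i = diag(I_(i-1), M, I_(n-i-1))`,
`R_i = diag(I_(i-1), N, I_(n-i-1))`. If `L_i^2 = R_i^2 = 1`, the `L_i` and the `R_i`
satisfy the braid relations, and `R_i R_(i+1) L_i = L_(i+1) R_i R_(i+1)` (so that
`l_i ↦ L_i`, `rho_i ↦ R_i` is a non-trivial homogeneous 2-local representation of
`VL_n`), then `N = [[0,x],[1/x,0]]` for some nonzero `x`, and either `M = I_2` or
`M = [[0,b],[1/b,0]]` for some nonzero `b`. -/
theorem homogeneous_two_local_VL_classification (n : ℕ) (hn : 3 ≤ n)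
    (M N : Matrix (Fin 2) (Fin 2) ℂ) (hM : IsUnit M) (hN : IsUnit N)
    (hnt : ¬ (M = 1 ∧ N = 1))
    (hL2 : ∀ i : Fin (n - 1), locMat n (i : ℕ) M * locMat n (i : ℕ) M = 1)
    (hR2 : ∀ i : Fin (n - 1), locMat n (i : ℕ) N * locMat n (i : ℕ) N = 1)
    (hLbr : ∀ i j : Fin (n - 1), (i : ℕ) + 1 = (j : ℕ) →
      locMat n (i : ℕ) M * locMat n (j : ℕ) M * locMat n (i : ℕ) M =
      locMat n (j : ℕ) M * locMat n (i : ℕ) M * locMat n (j : ℕ) M)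
    (hRbr : ∀ i j : Fin (n - 1), (i : ℕ) + 1 = (j : ℕ) →
      locMat n (i : ℕ) N * locMat n (j : ℕ) N * locMat n (i : ℕ) N =
      locMat n (j : ℕ) N * locMat n (i : ℕ) N * locMat n (j : ℕ) N)
    (hmix : ∀ i j : Fin (n - 1), (i : ℕ) + 1 = (j : ℕ) →
      locMat n (i : ℕ) N * locMat n (j : ℕ) N * locMat n (i : ℕ) M =
      locMat n (j : ℕ) M * locMat n (i : ℕ) N * locMat n (j : ℕ) N) :
    (∃ x : ℂ, x ≠ 0 ∧ N = !![0, x; 1 / x, 0]) ∧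
    (M = 1 ∨ ∃ b : ℂ, b ≠ 0 ∧ M = !![0, b; 1 / b, 0]) := by
  obtain ⟨m, rfl⟩ := Nat.exists_eq_add_of_le' hn
  let i : Fin (m + 3 - 1) := ⟨0, by omega⟩
  let j : Fin (m + 3 - 1) := ⟨1, by omega⟩
  have hMc := eq_one_or_antidiag_of_locMat_braid m M (hL2 i) (hLbr i j rfl)
  refine ⟨(eq_one_or_antidiag_of_locMat_braid m N (hR2 i) (hRbr i j rfl)).resolve_left
    fun hN1 => hnt ⟨eq_one_of_locMat_eq m M ?_, hN1⟩, hMc⟩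
  simpa [hN1, locMat_one, i, j] using hmix i j rfl
end
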